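/- Every semi-algebraic set in ℝⁿ (a finite union of sets each defined by finitely many polynomial equations and inequalities) has finitely many connected components. -/

import Mathlib

/-- A basic semi-algebraic set: finitely many polynomial equations `P = 0`
and inequalities `Q ≥ 0`. -/
def IsBasicSemialgebraic {n : ℕ} (S : Set (Fin n → ℝ)) : Prop :=
  ∃ (P Q : Finset (MvPolynomial (Fin n) ℝ)),
    S = {x | (∀ p ∈ P, MvPolynomial.eval x p = 0) ∧ (∀ q ∈ Q, 0 ≤ MvPolynomial.eval x q)}

/-- A semi-algebraic set: a finite union of basic semi-algebraic sets. -/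
def IsSemialgebraic {n : ℕ} (S : Set (Fin n → ℝ)) : Prop :=
  ∃ (k : ℕ) (B : Fin k → Set (Fin n → ℝ)),
    (∀ i, IsBasicSemialgebraic (B i)) ∧ S = ⋃ i, B i

open Polynomial

namespace SA

/-- identically zero or nowhere zero -/
def ZInv {Y : Type*} (g : Y → ℝ) : Prop := (∀ y, g y = 0) ∨ (∀ y, g y ≠ 0)

/-- on a preconnected space a continuous nowhere vanishing function has constant sign -/
lemma pos_of_pos {Y : Type*} [TopologicalSpace Y] [PreconnectedSpace Y] {g : Y → ℝ}
    (hg : Continuous g) (h0 : ∀ y, g y ≠ 0) {a : Y} (ha : 0 < g a) (b : Y) : 0 < g b := by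
  by_contra hb
  obtain ⟨c, hc⟩ := mem_range_of_exists_le_of_exists_ge hg ⟨b, not_lt.1 hb⟩ ⟨a, ha.le⟩
  exact h0 c hc

lemma neg_of_neg {Y : Type*} [TopologicalSpace Y] [PreconnectedSpace Y] {g : Y → ℝ}
    (hg : Continuous g) (h0 : ∀ y, g y ≠ 0) {a : Y} (ha : g a < 0) (b : Y) : g b < 0 := by
  have := pos_of_pos (g := fun y => - g y) hg.neg (fun y => neg_ne_zero.2 (h0 y)) (a := a)
    (by simpa using ha) b
  simpa using this

lemma ivt_zero {g : ℝ → ℝ} (hg : Continuous g) {a b : ℝ} (hab : a < b) (h : g a * g b < 0) :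
    ∃ t, a < t ∧ t < b ∧ g t = 0 := by
  rcases mul_neg_iff.1 h with ⟨h1, h2⟩ | ⟨h1, h2⟩
  · obtain ⟨t, ht, h⟩ := intermediate_value_Ioo' hab.le hg.continuousOn (show (0:ℝ) ∈ _ from ⟨h2, h1⟩)
    exact ⟨t, ht.1, ht.2, h⟩
  · obtain ⟨t, ht, h⟩ := intermediate_value_Ioo hab.le hg.continuousOn (show (0:ℝ) ∈ _ from ⟨h1, h2⟩)
    exact ⟨t, ht.1, ht.2, h⟩

lemma band {Y : Type*} [TopologicalSpace Y] [PreconnectedSpace Y] [Nonempty Y] {φ : Y → ℝ → ℝ}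
    (hφ : Continuous (fun p : Y × ℝ => φ p.1 p.2)) {l u : Y → ℝ} (hl : Continuous l)
    (hu : Continuous u) (hlu : ∀ y, l y < u y)
    (hinj : ∀ y, Set.InjOn (φ y) (Set.Icc (l y) (u y)))
    (h1 : ZInv fun y => φ y (l y)) (h2 : ZInv fun y => φ y (u y)) :
    (∀ y t, l y < t → t < u y → φ y t ≠ 0) ∨
    ∃ ζ : Y → ℝ, Continuous ζ ∧ (∀ y, l y < ζ y) ∧ (∀ y, ζ y < u y) ∧ ∀ y, φ y (ζ y) = 0 := by
  have hφy : ∀ y, Continuous (φ y) := fun y =>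
    hφ.comp (continuous_const.prodMk continuous_id)
  have hcomp : ∀ {s : Y → ℝ}, Continuous s → Continuous fun y => φ y (s y) := fun hs =>
    hφ.comp (continuous_id.prodMk hs)
  have key : ∀ y t s r, l y ≤ t → t < s → s < r → r ≤ u y → φ y s = 0 → φ y t * φ y r < 0 := by
    intro y t s r h1 h2 h3 h4 h0
    have mt : t ∈ Set.Icc (l y) (u y) := ⟨h1, by linarith⟩
    have ms : s ∈ Set.Icc (l y) (u y) := ⟨by linarith, by linarith⟩
    have mr : r ∈ Set.Icc (l y) (u y) := ⟨by linarith, h4⟩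
    rcases (hφy y).continuousOn.strictMonoOn_of_injOn_Icc' (hlu y).le (hinj y) with hm | hm
    · have := hm mt ms h2
      have := hm ms mr h3
      exact mul_neg_of_neg_of_pos (by linarith) (by linarith)
    · have := hm mt ms h2
      have := hm ms mr h3
      exact mul_neg_of_pos_of_neg (by linarith) (by linarith)
  by_cases hneg : ∃ y, φ y (l y) * φ y (u y) < 0
  · right
    obtain ⟨y0, hy0⟩ := hneg
    have hall : ∀ y, φ y (l y) * φ y (u y) < 0 := by
      have h1' : ∀ y, φ y (l y) ≠ 0 := by
        rcases h1 with h1 | h1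
        · simp [h1 y0] at hy0
        · exact h1
      have h2' : ∀ y, φ y (u y) ≠ 0 := by
        rcases h2 with h2 | h2
        · simp [h2 y0] at hy0
        · exact h2
      exact neg_of_neg ((hcomp hl).mul (hcomp hu)) (fun y => mul_ne_zero (h1' y) (h2' y)) hy0
    choose ζ hz1 hz2 hz3 using fun y => ivt_zero (hφy y) (hlu y) (hall y)
    refine ⟨ζ, ?_, hz1, hz2, hz3⟩
    have uniq : ∀ y t, l y < t → t < u y → φ y t = 0 → t = ζ y := fun y t a b c =>
      hinj y ⟨a.le, b.le⟩ ⟨(hz1 y).le, (hz2 y).le⟩ (c.trans (hz3 y).symm)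
    rw [continuous_iff_continuousAt]
    intro y0
    refine tendsto_order.2 ⟨fun a ha => ?_, fun a ha => ?_⟩
    · obtain ⟨t, ht1, ht2⟩ := exists_between (max_lt ha (hz1 y0))
      have hs := key y0 t (ζ y0) (u y0) ((le_max_right _ _).trans ht1.le) ht2 (hz2 y0) le_rfl (hz3 y0)
      have e1 : ∀ᶠ y in nhds y0, φ y t * φ y (u y) < 0 :=
        (((hcomp continuous_const).mul (hcomp hu)).tendsto y0).eventually_lt_const hs
      have e2 : ∀ᶠ y in nhds y0, l y < t :=
        (hl.tendsto y0).eventually_lt_const ((le_max_right _ _).trans_lt ht1)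
      have e3 : ∀ᶠ y in nhds y0, t < u y :=
        (hu.tendsto y0).eventually_const_lt (ht2.trans (hz2 y0))
      filter_upwards [e1, e2, e3] with y e1 e2 e3
      obtain ⟨s, hs1, hs2, hs3⟩ := ivt_zero (hφy y) e3 e1
      rw [← uniq y s (e2.trans hs1) hs2 hs3]
      exact ((le_max_left _ _).trans_lt ht1).trans hs1
    · obtain ⟨t, ht1, ht2⟩ := exists_between (lt_min ha (hz2 y0))
      have hs := key y0 (l y0) (ζ y0) t le_rfl (hz1 y0) ht1 (ht2.le.trans (min_le_right _ _)) (hz3 y0)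
      have e1 : ∀ᶠ y in nhds y0, φ y (l y) * φ y t < 0 :=
        (((hcomp hl).mul (hcomp continuous_const)).tendsto y0).eventually_lt_const hs
      have e2 : ∀ᶠ y in nhds y0, t < u y :=
        (hu.tendsto y0).eventually_const_lt (ht2.trans_le (min_le_right _ _))
      have e3 : ∀ᶠ y in nhds y0, l y < t :=
        (hl.tendsto y0).eventually_lt_const ((hz1 y0).trans ht1)
      filter_upwards [e1, e2, e3] with y e1 e2 e3
      obtain ⟨s, hs1, hs2, hs3⟩ := ivt_zero (hφy y) e3 e1
      rw [← uniq y s hs1 (hs2.trans e2) hs3]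
      exact hs2.trans (ht2.trans_le (min_le_left _ _))
  · left
    intro y t a b c
    exact hneg ⟨y, key y _ t _ le_rfl a b le_rfl c⟩

/-- a family of continuous functions, pairwise never meeting -/
structure Chain {Y : Type*} [TopologicalSpace Y] (Ξ : Set (Y → ℝ)) : Prop where
  fin : Ξ.Finite
  cont : ∀ ξ ∈ Ξ, Continuous ξ
  cmp : ∀ ξ ∈ Ξ, ∀ η ∈ Ξ, ξ = η ∨ (∀ y, ξ y < η y) ∨ (∀ y, η y < ξ y)

lemma Chain.subset {Y : Type*} [TopologicalSpace Y] {Ξ Ξ' : Set (Y → ℝ)} (h : Chain Ξ)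
    (hs : Ξ' ⊆ Ξ) : Chain Ξ' :=
  ⟨h.fin.subset hs, fun ξ hξ => h.cont ξ (hs hξ), fun ξ hξ η hη => h.cmp ξ (hs hξ) η (hs hη)⟩

lemma Chain.eq {Y : Type*} [TopologicalSpace Y] {Ξ : Set (Y → ℝ)} (h : Chain Ξ)
    {ξ η : Y → ℝ} (hξ : ξ ∈ Ξ) (hη : η ∈ Ξ) {y : Y} (hy : ξ y = η y) : ξ = η := by
  rcases h.cmp ξ hξ η hη with h | h | h
  · exact h
  · exact absurd hy (h y).ne
  · exact absurd hy (h y).ne'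

lemma Chain.le {Y : Type*} [TopologicalSpace Y] {Ξ : Set (Y → ℝ)} (h : Chain Ξ)
    {ξ η : Y → ℝ} (hξ : ξ ∈ Ξ) (hη : η ∈ Ξ) {y : Y} (hy : ξ y ≤ η y) (z : Y) : ξ z ≤ η z := by
  rcases h.cmp ξ hξ η hη with h | h | h
  · rw [h]
  · exact (h z).le
  · exact absurd (h y) hy.not_gt

lemma Chain.lt {Y : Type*} [TopologicalSpace Y] {Ξ : Set (Y → ℝ)} (h : Chain Ξ)
    {ξ η : Y → ℝ} (hξ : ξ ∈ Ξ) (hη : η ∈ Ξ) {y : Y} (hy : ξ y < η y) (z : Y) : ξ z < η z := by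
  rcases h.cmp ξ hξ η hη with h | h | h
  · rw [h] at hy; exact absurd hy (lt_irrefl _)
  · exact (h z)
  · exact absurd (h y) hy.not_gt

/-- consecutive members of a chain -/
def Adj {Y : Type*} (Ξ : Set (Y → ℝ)) (p : (Y → ℝ) × (Y → ℝ)) : Prop :=
  p.1 ∈ Ξ ∧ p.2 ∈ Ξ ∧ (∀ y, p.1 y < p.2 y) ∧ ∀ ξ ∈ Ξ, (∀ y, ξ y ≤ p.1 y) ∨ (∀ y, p.2 y ≤ ξ y)

lemma Chain.adj {Y : Type*} [TopologicalSpace Y] {Ξ : Set (Y → ℝ)} (h : Chain Ξ)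
    {y : Y} {t : ℝ} {a b : Y → ℝ} (ha : a ∈ Ξ) (hb : b ∈ Ξ) (hat : a y < t) (hbt : t < b y)
    (hne : ∀ ξ ∈ Ξ, ξ y ≠ t) : ∃ p, Adj Ξ p ∧ p.1 y < t ∧ t < p.2 y := by
  obtain ⟨l, ⟨hl, hlt⟩, hlm⟩ := Set.exists_max_image (Ξ ∩ {ξ | ξ y < t}) (fun ξ => ξ y)
    (h.fin.inter_of_left _) ⟨a, ha, hat⟩
  obtain ⟨u, ⟨hu, hut⟩, hum⟩ := Set.exists_min_image (Ξ ∩ {ξ | t < ξ y}) (fun ξ => ξ y)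
    (h.fin.inter_of_left _) ⟨b, hb, hbt⟩
  refine ⟨(l, u), ⟨hl, hu, h.lt hl hu (lt_trans hlt hut), fun ξ hξ => ?_⟩, hlt, hut⟩
  rcases lt_or_gt_of_ne (hne ξ hξ) with h' | h'
  · exact Or.inl (h.le hξ hl (hlm ξ ⟨hξ, h'⟩))
  · exact Or.inr (h.le hu hξ (hum ξ ⟨hξ, h'⟩))

/-- abstract insertion of the zero sections of `φ`, into bounded chain. -/
lemma insertion {Y : Type*} [TopologicalSpace Y] [PreconnectedSpace Y] [Nonempty Y] {φ : Y → ℝ → ℝ}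
    (hφ : Continuous (fun p : Y × ℝ => φ p.1 p.2)) {Ξ : Set (Y → ℝ)} (h : Chain Ξ)
    (hz : ∀ ξ ∈ Ξ, ZInv fun y => φ y (ξ y))
    (hinj : ∀ p, Adj Ξ p → ∀ y, Set.InjOn (φ y) (Set.Icc (p.1 y) (p.2 y)))
    {a b : Y → ℝ} (ha : a ∈ Ξ) (hb : b ∈ Ξ)
    (hab : ∀ y t, φ y t = 0 → a y < t ∧ t < b y) :
    ∃ Ξ', Chain Ξ' ∧ Ξ ⊆ Ξ' ∧ (∀ ξ ∈ Ξ', ZInv fun y => φ y (ξ y)) ∧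
      (∀ y t, φ y t = 0 → ∃ ξ ∈ Ξ', ξ y = t) := by
  have H : ∀ p : (Y → ℝ) × (Y → ℝ), ∃ ζ : Y → ℝ, Adj Ξ p →
      (∀ y t, p.1 y < t → t < p.2 y → φ y t ≠ 0) ∨
      (Continuous ζ ∧ (∀ y, p.1 y < ζ y) ∧ (∀ y, ζ y < p.2 y) ∧ ∀ y, φ y (ζ y) = 0) := by
    intro p
    by_cases hp : Adj Ξ p
    · rcases band hφ (h.cont _ hp.1) (h.cont _ hp.2.1) hp.2.2.1 (hinj p hp) (hz _ hp.1)
        (hz _ hp.2.1) with h' | ⟨ζ, h'⟩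
      · exact ⟨0, fun _ => Or.inl h'⟩
      · exact ⟨ζ, fun _ => Or.inr h'⟩
    · exact ⟨0, fun h => absurd h hp⟩
  choose ζ hζ using H
  let I : Set ((Y → ℝ) × (Y → ℝ)) := {p | Adj Ξ p ∧ Continuous (ζ p) ∧ (∀ y, p.1 y < ζ p y) ∧
    (∀ y, ζ p y < p.2 y) ∧ ∀ y, φ y (ζ p y) = 0}
  have hI : I.Finite := (h.fin.prod h.fin).subset fun p hp => ⟨hp.1.1, hp.1.2.1⟩
  have c1 : ∀ ξ ∈ Ξ, ∀ p ∈ I, (∀ y, ξ y < ζ p y) ∨ (∀ y, ζ p y < ξ y) := by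
    rintro ξ hξ p ⟨hp, -, h1, h2, -⟩
    rcases hp.2.2.2 ξ hξ with h' | h'
    · exact Or.inl fun y => (h' y).trans_lt (h1 y)
    · exact Or.inr fun y => (h2 y).trans_le (h' y)
  refine ⟨Ξ ∪ ζ '' I, ⟨h.fin.union (hI.image _), ?_, ?_⟩, Set.subset_union_left, ?_, ?_⟩
  · rintro ξ (hξ | ⟨p, hp, rfl⟩)
    · exact h.cont ξ hξ
    · exact hp.2.1
  · rintro ξ (hξ | ⟨p, hp, rfl⟩) η (hη | ⟨q, hq, rfl⟩)
    · exact h.cmp ξ hξ η hη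
    · exact Or.inr (c1 ξ hξ q hq)
    · exact Or.inr (c1 η hη p hp).symm
    · rcases hq.1.2.2.2 _ hp.1.1 with h1 | h1
      · rcases hp.1.2.2.2 _ hq.1.1 with h2 | h2
        · rcases hq.1.2.2.2 _ hp.1.2.1 with h3 | h3
          · inhabit Y
            have a1 := h3 default
            have a2 := h2 default
            have a3 := hp.1.2.2.1 default
            linarith
          rcases hp.1.2.2.2 _ hq.1.2.1 with h4 | h4
          · inhabit Y
            have a1 := h4 default
            have a2 := h1 default
            have a3 := hq.1.2.2.1 default
            linarith
          left
          congr 1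
          exact Prod.ext (funext fun y => le_antisymm (h1 y) (h2 y))
            (funext fun y => le_antisymm (h4 y) (h3 y))
        · exact Or.inr (Or.inl fun y => (hp.2.2.2.1 y).trans_le ((h2 y).trans (hq.2.2.1 y).le))
      · exact Or.inr (Or.inr fun y => (hq.2.2.2.1 y).trans_le ((h1 y).trans (hp.2.2.1 y).le))
  · rintro ξ (hξ | ⟨p, hp, rfl⟩)
    · exact hz ξ hξ
    · exact Or.inl hp.2.2.2.2
  · intro y t ht
    by_cases hne : ∃ ξ ∈ Ξ, ξ y = t
    · obtain ⟨ξ, hξ, h⟩ := hne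
      exact ⟨ξ, Or.inl hξ, h⟩
    · push Not at hne
      obtain ⟨p, hp, h1, h2⟩ := h.adj ha hb (hab y t ht).1 (hab y t ht).2 hne
      rcases hζ p hp with h' | h'
      · exact absurd ht (h' y t h1 h2)
      · refine ⟨ζ p, Or.inr ⟨p, ⟨hp, h'⟩, rfl⟩, ?_⟩
        exact hinj p hp y ⟨(h'.2.1 y).le, (h'.2.2.1 y).le⟩ ⟨h1.le, h2.le⟩
          ((h'.2.2.2 y).trans ht.symm)


/-- evaluation of a polynomial with coefficients depending on `y` -/
noncomputable def E {A : Type*} [CommRing A] {Y : Type*} (ev : Y → A →+* ℝ) (f : A[X]) (y : Y) (t : ℝ) : ℝ :=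
  f.eval₂ (ev y) t

lemma E_cont {A : Type*} [CommRing A] {Y : Type*} [TopologicalSpace Y] {ev : Y → A →+* ℝ}
    (hev : ∀ a, Continuous fun y => ev y a) (f : A[X]) :
    Continuous fun p : Y × ℝ => E ev f p.1 p.2 := by
  simp only [E, eval₂_eq_sum_range]
  exact continuous_finsetSum _ fun i _ =>
    ((hev _).comp continuous_fst).mul (continuous_snd.pow i)

/-- All zeros of members of `F` lie on a chain of sections; members are `ZInv` on sections. -/
def Nice {A : Type*} [CommRing A] {Y : Type*} [TopologicalSpace Y] (ev : Y → A →+* ℝ)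
    (F : Finset A[X]) : Prop :=
  ∃ Ξ : Set (Y → ℝ), Chain Ξ ∧ ∀ f ∈ F, (∀ ξ ∈ Ξ, ZInv fun y => E ev f y (ξ y)) ∧
    ((∀ y t, E ev f y t = 0) ∨ ∀ y t, E ev f y t = 0 → ∃ ξ ∈ Ξ, ξ y = t)

/-- truncation -/
noncomputable def tr {A : Type*} [CommRing A] (g : A[X]) (k : ℕ) : A[X] :=
  ∑ i ∈ Finset.range (k + 1), C (g.coeff i) * X ^ i

/-- one step of pseudo-division -/
noncomputable def red {A : Type*} [CommRing A] (f g : A[X]) (D k : ℕ) : A[X] :=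
  C (g.coeff k) * f - C (f.coeff D) * (X ^ (D - k) * tr g k)

lemma tr_coeff {A : Type*} [CommRing A] (g : A[X]) (k j : ℕ) :
    (tr g k).coeff j = if j ≤ k then g.coeff j else 0 := by
  simp [tr, coeff_X_pow]

lemma red_natDegree {A : Type*} [CommRing A] (f g : A[X]) (d k : ℕ) (hf : f.natDegree ≤ d + 1)
    (hk : k ≤ d + 1) : (red f g (d + 1) k).natDegree ≤ d := by
  rw [natDegree_le_iff_coeff_eq_zero]
  intro N hN
  have h1 : d + 1 - k ≤ N := by omega
  rw [red, coeff_sub, coeff_C_mul, coeff_C_mul, coeff_X_pow_mul', if_pos h1, tr_coeff]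
  rcases eq_or_lt_of_le (Nat.succ_le_of_lt hN) with rfl | h
  · have : d.succ - (d + 1 - k) = k := by omega
    rw [this, if_pos le_rfl, Nat.succ_eq_add_one]; ring
  · rw [if_neg (by omega), coeff_eq_zero_of_natDegree_lt (p := f) (by omega)]; simp

lemma E_tr {A : Type*} [CommRing A] {Y : Type*} {ev : Y → A →+* ℝ} (g : A[X]) (k : ℕ) (y : Y)
    (h : ∀ i, k < i → ev y (g.coeff i) = 0) (t : ℝ) : E ev (tr g k) y t = E ev g y t := by
  have : (tr g k).map (ev y) = g.map (ev y) := by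
    ext j
    rw [coeff_map, coeff_map, tr_coeff]
    split_ifs with hj
    · rfl
    · rw [h j (by omega), map_zero]
  rw [E, E, ← eval_map, this, eval_map]

lemma E_red {A : Type*} [CommRing A] {Y : Type*} {ev : Y → A →+* ℝ} (f g : A[X]) (D k : ℕ) (y : Y)
    (h : ∀ i, k < i → ev y (g.coeff i) = 0) (t : ℝ) (h0 : E ev g y t = 0) :
    E ev (red f g D k) y t = ev y (g.coeff k) * E ev f y t := by
  have h1 := E_tr g k y h t
  rw [h0] at h1
  simp only [E] at h1 ⊢
  simp [red, eval₂_sub, eval₂_mul, h1]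

lemma root_bound (p : ℝ[X]) (hp : p ≠ 0) (t : ℝ) (ht : p.eval t = 0) :
    |t| < (∑ i ∈ Finset.range p.natDegree, |p.coeff i|) / |p.leadingCoeff| + 1 := by
  have h := IsRoot.norm_lt_cauchyBound hp (a := t) ht
  have h' : |t| < (cauchyBound p : ℝ) := by exact_mod_cast h
  refine h'.trans_le ?_
  have h2 : cauchyBound p ≤ (∑ i ∈ Finset.range p.natDegree, ‖p.coeff i‖₊) / ‖p.leadingCoeff‖₊ + 1 := by
    unfold cauchyBound
    gcongr
    refine Finset.sup_le fun i hi => ?_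
    exact Finset.single_le_sum (f := fun i => ‖p.coeff i‖₊) (fun _ _ => zero_le) hi
  have h3 := NNReal.coe_le_coe.2 h2
  push_cast at h3
  exact h3

lemma E_hasDeriv {A : Type*} [CommRing A] {Y : Type*} {ev : Y → A →+* ℝ} (f : A[X]) (y : Y) (t : ℝ) :
    HasDerivAt (E ev f y) (E ev (derivative f) y t) t := by
  have := (f.map (ev y)).hasDerivAt t
  rw [derivative_map, eval_map] at this
  have h : E ev f y = fun x => eval x (f.map (ev y)) := by
    funext s
    rw [E, eval_map]
  rw [h]
  exact this

lemma step {A : Type*} [CommRing A] {Y : Type*} [TopologicalSpace Y] [PreconnectedSpace Y]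
    [Nonempty Y] {ev : Y → A →+* ℝ} (hev : ∀ a, Continuous fun y => ev y a)
    {f : A[X]} {D : ℕ} (hD : f.natDegree = D) (hD0 : D ≠ 0) {F' F₃ : Finset A[X]}
    (hF' : ∀ g ∈ F', g.natDegree ≤ D) (hN : Nice ev F₃) (hsub : F' ⊆ F₃)
    (hder : derivative f ∈ F₃) (hlead : f.eraseLead ∈ F₃)
    (hred : ∀ g, (g = derivative f ∨ g ∈ F') → ∀ k ≤ D, red f g D k ∈ F₃)
    (hcf : ZInv fun y => ev y f.leadingCoeff)
    (hcg : ∀ g, (g = derivative f ∨ g ∈ F') → ∀ k, ZInv fun y => ev y (g.coeff k)) :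
    ∀ F : Finset A[X], (∀ g ∈ F, g = f ∨ g ∈ F') → Nice ev F := by
  classical
  intro F hF
  obtain ⟨Ξ, hΞ, hz⟩ := hN
  rcases hcf with hcf | hcf
  · refine ⟨Ξ, hΞ, fun g hg => ?_⟩
    rcases hF g hg with rfl | hg
    · have : ∀ y t, E ev g y t = E ev g.eraseLead y t := by
        intro y t
        have := congrArg (eval₂ (ev y) t) g.eraseLead_add_monomial_natDegree_leadingCoeff
        have h0 : ev y g.leadingCoeff = 0 := hcf y
        rw [eval₂_add, eval₂_monomial, h0] at this
        simp only [zero_mul, add_zero] at this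
        exact this.symm
      simp only [this]
      exact hz _ hlead
    · exact hz g (hsub hg)
  have hlc : ∀ y, (f.map (ev y)).leadingCoeff = ev y f.leadingCoeff := fun y =>
    leadingCoeff_map_of_leadingCoeff_ne_zero _ (hcf y)
  have hnd : ∀ y, (f.map (ev y)).natDegree = D := fun y =>
    (natDegree_map_of_leadingCoeff_ne_zero _ (hcf y)).trans hD
  have hne : ∀ y, f.map (ev y) ≠ 0 := fun y h => by
    have := hlc y; rw [h, leadingCoeff_zero] at this; exact hcf y this.symm
  have hdegF : ∀ g, (g = derivative f ∨ g ∈ F') → g.natDegree ≤ D := by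
    rintro g (rfl | hg)
    · exact (natDegree_derivative_le f).trans (by omega)
    · exact hF' g hg
  have hF3 : ∀ g, (g = derivative f ∨ g ∈ F') → g ∈ F₃ := by
    rintro g (rfl | hg)
    · exact hder
    · exact hsub hg
  let Ξ₀ : Set (Y → ℝ) := {ξ | ξ ∈ Ξ ∧ ∃ g, (g = derivative f ∨ g ∈ F') ∧
    (¬ ∀ y t, E ev g y t = 0) ∧ ∀ y, E ev g y (ξ y) = 0}
  have hΞ₀ : Chain Ξ₀ := hΞ.subset fun ξ h => h.1
  have hzero : ∀ g, (g = derivative f ∨ g ∈ F') → (∀ y t, E ev g y t = 0) ∨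
      ∀ y t, E ev g y t = 0 → ∃ ξ ∈ Ξ₀, ξ y = t ∧ ∀ y, E ev g y (ξ y) = 0 := by
    intro g hg
    by_cases h0 : ∀ y t, E ev g y t = 0
    · exact Or.inl h0
    refine Or.inr fun y t ht => ?_
    obtain ⟨ξ, hξ, rfl⟩ := (hz g (hF3 g hg)).2.resolve_left h0 y t ht
    have : ∀ y, E ev g y (ξ y) = 0 :=
      ((hz g (hF3 g hg)).1 ξ hξ).resolve_right fun h => h y ht
    exact ⟨ξ, ⟨hξ, g, hg, h0, this⟩, rfl, this⟩
  have hfz : ∀ ξ ∈ Ξ₀, ZInv fun y => E ev f y (ξ y) := by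
    rintro ξ ⟨hξ, g, hg, hg0, hgξ⟩
    have hex : ∃ k, k ∈ g.support.filter fun k => ¬ ∀ y, ev y (g.coeff k) = 0 := by
      by_contra hcon
      push Not at hcon
      apply hg0
      intro y t
      rw [E, eval₂_eq_sum, Polynomial.sum]
      refine Finset.sum_eq_zero fun i hi => ?_
      have := hcon i
      rw [Finset.mem_filter, not_and] at this
      push Not at this
      rw [this hi y, zero_mul]
    obtain ⟨k, hk, hkm⟩ := Finset.exists_max_image _ id hex
    rw [Finset.mem_filter] at hk
    have hk1 : ∀ y, ev y (g.coeff k) ≠ 0 := (hcg g hg k).resolve_left hk.2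
    have hk2 : ∀ i, k < i → ∀ y, ev y (g.coeff i) = 0 := by
      intro i hi
      by_contra hcon
      have : i ∈ g.support := by
        rw [mem_support_iff]; intro h; apply hcon; intro y; rw [h, map_zero]
      exact absurd (hkm i (Finset.mem_filter.2 ⟨this, hcon⟩)) (not_le.2 hi)
    have hkD : k ≤ D := (le_natDegree_of_mem_supp k hk.1).trans (hdegF g hg)
    have hr : ∀ y, E ev (red f g D k) y (ξ y) = ev y (g.coeff k) * E ev f y (ξ y) := fun y =>
      E_red f g D k y (fun i hi => hk2 i hi y) _ (hgξ y)
    rcases (hz _ (hred g hg k hkD)).1 ξ hξ with h | h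
    · exact Or.inl fun y => (mul_eq_zero.1 ((hr y).symm.trans (h y))).resolve_left (hk1 y)
    · exact Or.inr fun y h' => h y (by simp only [hr y, h', mul_zero])
  let M : Y → ℝ := fun y => (∑ i ∈ Finset.range D, |ev y (f.coeff i)|) / |ev y f.leadingCoeff| + 1 +
    ∑ ξ ∈ hΞ₀.fin.toFinset, |ξ y|
  have hMc : Continuous M := by
    refine ((Continuous.div ?_ (hev _).abs fun y => abs_ne_zero.2 (hcf y)).add
      continuous_const).add ?_
    · exact continuous_finsetSum _ fun i _ => (hev _).abs
    · exact continuous_finsetSum _ fun ξ hξ => (hΞ₀.cont ξ (by simpa using hξ)).abs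
  have hM1 : ∀ y t, E ev f y t = 0 → |t| < M y := by
    intro y t ht
    have := root_bound (f.map (ev y)) (hne y) t (by rw [eval_map]; exact ht)
    rw [hlc, hnd] at this
    simp only [coeff_map] at this
    have h2 : 0 ≤ ∑ ξ ∈ hΞ₀.fin.toFinset, |ξ y| := Finset.sum_nonneg fun _ _ => abs_nonneg _
    simp only [M]
    linarith
  have hM2 : ∀ ξ ∈ Ξ₀, ∀ y, |ξ y| < M y := by
    intro ξ hξ y
    have h1 : |ξ y| ≤ ∑ ξ ∈ hΞ₀.fin.toFinset, |ξ y| :=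
      Finset.single_le_sum (f := fun ξ : Y → ℝ => |ξ y|) (fun _ _ => abs_nonneg _) (by simpa using hξ)
    have h2 : 0 ≤ (∑ i ∈ Finset.range D, |ev y (f.coeff i)|) / |ev y f.leadingCoeff| := by positivity
    simp only [M]
    linarith
  have hM0 : ∀ y, 0 < M y := by
    intro y
    simp only [M]
    positivity
  let Ξ₁ : Set (Y → ℝ) := insert M (insert (fun y => - M y) Ξ₀)
  have hsub1 : Ξ₀ ⊆ Ξ₁ := fun ξ h => Or.inr (Or.inr h)
  have hΞ₁ : Chain Ξ₁ := by
    refine ⟨(hΞ₀.fin.insert _).insert _, ?_, ?_⟩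
    · rintro ξ (rfl | rfl | hξ)
      · exact hMc
      · exact hMc.neg
      · exact hΞ₀.cont ξ hξ
    · rintro ξ (rfl | rfl | hξ) η (rfl | rfl | hη)
      · exact Or.inl rfl
      · exact Or.inr (Or.inr fun y => by linarith [hM0 y])
      · exact Or.inr (Or.inr fun y => (abs_lt.1 (hM2 η hη y)).2)
      · exact Or.inr (Or.inl fun y => by linarith [hM0 y])
      · exact Or.inl rfl
      · exact Or.inr (Or.inl fun y => (abs_lt.1 (hM2 η hη y)).1)
      · exact Or.inr (Or.inl fun y => (abs_lt.1 (hM2 ξ hξ y)).2)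
      · exact Or.inr (Or.inr fun y => (abs_lt.1 (hM2 ξ hξ y)).1)
      · exact hΞ₀.cmp ξ hξ η hη
  have hder0 : ¬ ∀ y t, E ev (derivative f) y t = 0 := by
    intro h
    inhabit Y
    have h1 : (derivative f).map (ev default) = 0 :=
      Polynomial.funext fun t => by rw [eval_map, eval_zero]; exact h default t
    have h2 := congrArg (fun p => coeff p (D - 1)) h1
    simp only [coeff_map, coeff_derivative, coeff_zero] at h2
    have h3 : D - 1 + 1 = D := by omega
    rw [h3, map_mul, ← hD, coeff_natDegree, hD] at h2
    have h4 : (ev default) (((D - 1 : ℕ) : A) + 1) = (D : ℝ) := by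
      rw [map_add, map_natCast, map_one]; exact_mod_cast h3
    rw [h4] at h2
    rcases mul_eq_zero.1 h2 with h2 | h2
    · exact hcf _ h2
    · exact hD0 (by exact_mod_cast h2)
  obtain ⟨Ξ₂, hΞ₂, hsub2, hf2, hf2'⟩ := insertion (E_cont hev f) hΞ₁ (a := fun y => - M y) (b := M) (by
      rintro ξ (rfl | rfl | hξ)
      · exact Or.inr fun y h => absurd (hM1 y _ h) (not_lt.2 (le_abs_self _))
      · exact Or.inr fun y h => absurd (hM1 y _ h) (not_lt.2 (by rw [abs_neg]; exact le_abs_self _))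
      · exact hfz ξ hξ) (by
      intro p hp y
      have noz : ∀ t, p.1 y < t → t < p.2 y → E ev (derivative f) y t ≠ 0 := by
        intro t h1 h2 h3
        obtain ⟨ξ, hξ, rfl, -⟩ := (hzero _ (Or.inl rfl)).resolve_left hder0 y t h3
        rcases hp.2.2.2 ξ (hsub1 hξ) with h | h
        · exact absurd (h y) (not_le.2 h1)
        · exact absurd (h y) (not_le.2 h2)
      have wl : ∀ s t, p.1 y ≤ s → t ≤ p.2 y → s < t → E ev f y s ≠ E ev f y t := by
        intro s t h1 h2 h3 h4
        obtain ⟨c, hc, hc0⟩ := exists_hasDerivAt_eq_zero h3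
          (fun x _ => (E_hasDeriv f y x).continuousAt.continuousWithinAt) h4
          (fun x _ => E_hasDeriv (ev := ev) f y x)
        exact noz c (h1.trans_lt hc.1) (hc.2.trans_le h2) hc0
      intro s hs t ht hst
      rcases lt_trichotomy s t with h | h | h
      · exact absurd hst (wl s t hs.1 ht.2 h)
      · exact h
      · exact absurd hst.symm (wl t s ht.1 hs.2 h))
    (Or.inr (Or.inl rfl)) (Or.inl rfl) (fun y t h => abs_lt.1 (hM1 y t h))
  refine ⟨Ξ₂, hΞ₂, fun g hg => ?_⟩
  rcases hF g hg with rfl | hg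
  · exact ⟨hf2, Or.inr hf2'⟩
  · rcases hzero g (Or.inr hg) with h | h
    · exact ⟨fun ξ _ => Or.inl fun y => h y _, Or.inl h⟩
    · refine ⟨fun ξ hξ => ?_, Or.inr fun y t ht => ?_⟩
      · by_cases hex : ∃ y, E ev g y (ξ y) = 0
        · obtain ⟨y, hy⟩ := hex
          obtain ⟨η, hη, h1, h2⟩ := h y _ hy
          rw [← hΞ₂.eq (hsub2 (hsub1 hη)) hξ h1]
          exact Or.inl h2
        · push Not at hex
          exact Or.inr hex
      · obtain ⟨η, hη, h1, h2⟩ := h y _ ht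
        exact ⟨η, hsub2 (hsub1 hη), h1⟩

/-- projection theorem -/
lemma proj {A : Type} [CommRing A] (d : ℕ) : ∀ F : Finset A[X], (∀ f ∈ F, f.natDegree ≤ d) →
    ∃ G : Finset A, ∀ (Y : Type) [TopologicalSpace Y] [PreconnectedSpace Y] [Nonempty Y]
      (ev : Y → A →+* ℝ), (∀ a, Continuous fun y => ev y a) →
      (∀ a ∈ G, ZInv fun y => ev y a) → Nice ev F := by
  classical
  induction d with
  | zero =>
    intro F hF
    refine ⟨F.image fun f => f.coeff 0, fun Y _ _ _ ev hev hG => ⟨∅, ⟨Set.finite_empty, by simp, by simp⟩,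
      fun f hf => ⟨by simp, ?_⟩⟩⟩
    have : ∀ y t, E ev f y t = ev y (f.coeff 0) := fun y t => by
      conv_lhs => rw [eq_C_of_natDegree_le_zero (hF f hf)]
      simp [E]
    simp only [this]
    rcases hG _ (Finset.mem_image_of_mem _ hf) with h | h
    · exact Or.inl fun y _ => h y
    · exact Or.inr fun y _ h' => absurd h' (h y)
  | succ d ihd =>
    suffices H : ∀ m, ∀ F : Finset A[X], (∀ f ∈ F, f.natDegree ≤ d + 1) →
        (F.filter fun f => f.natDegree = d + 1).card ≤ m → ∃ G : Finset A,
        ∀ (Y : Type) [TopologicalSpace Y] [PreconnectedSpace Y] [Nonempty Y]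
        (ev : Y → A →+* ℝ), (∀ a, Continuous fun y => ev y a) →
        (∀ a ∈ G, ZInv fun y => ev y a) → Nice ev F from fun F hF => H _ F hF le_rfl
    intro m
    induction m with
    | zero =>
      intro F hF hc
      refine ihd F fun f hf => ?_
      have h1 := hF f hf
      have h2 : f.natDegree ≠ d + 1 := fun h => by
        have : f ∈ F.filter fun f => f.natDegree = d + 1 := Finset.mem_filter.2 ⟨hf, h⟩
        rw [Finset.card_eq_zero.1 (Nat.le_zero.1 hc)] at this
        simp at this
      omega
    | succ m ihm =>
      intro F hF hc
      by_cases hex : ∃ f ∈ F, f.natDegree = d + 1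
      swap
      · push Not at hex
        refine ihd F fun f hf => ?_
        have h1 := hF f hf
        have h2 := hex f hf
        omega
      obtain ⟨f, hf, hfd⟩ := hex
      let F₂ : Finset A[X] := insert (derivative f) (F.erase f)
      let R : Finset A[X] := F₂.biUnion fun g => (Finset.range (d + 2)).image fun k => red f g (d + 1) k
      let F₃ : Finset A[X] := insert f.eraseLead (F₂ ∪ R)
      have hder : (derivative f).natDegree ≤ d := by
        have := natDegree_derivative_lt (p := f) (by omega)
        omega
      have hel : f.eraseLead.natDegree ≤ d := by
        have := f.eraseLead_natDegree_le
        omega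
      have hmem : ∀ g ∈ F₃, g.natDegree ≤ d ∨ g ∈ F.erase f := by
        intro g hg
        simp only [F₃, F₂, R, Finset.mem_insert, Finset.mem_union, Finset.mem_biUnion,
          Finset.mem_image, Finset.mem_range] at hg
        rcases hg with rfl | (rfl | hg) | ⟨h, -, k, hk, rfl⟩
        · exact Or.inl hel
        · exact Or.inl hder
        · exact Or.inr hg
        · exact Or.inl (red_natDegree f h d k hfd.le (by omega))
      obtain ⟨G, hG⟩ := ihm F₃ (by
        intro g hg
        rcases hmem g hg with h | h
        · omega
        · exact hF g (Finset.mem_of_mem_erase h)) (by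
        have : (F₃.filter fun f => f.natDegree = d + 1) ⊆
            (F.filter fun f => f.natDegree = d + 1).erase f := by
          intro g hg
          rw [Finset.mem_filter] at hg
          rcases hmem g hg.1 with h | h
          · omega
          · rw [Finset.mem_erase] at h ⊢
            exact ⟨h.1, Finset.mem_filter.2 ⟨h.2, hg.2⟩⟩
        have h2 := Finset.card_le_card this
        rw [Finset.card_erase_of_mem (Finset.mem_filter.2 ⟨hf, hfd⟩)] at h2
        omega)
      refine ⟨insert f.leadingCoeff (G ∪ F₂.biUnion fun g => (Finset.range (d + 2)).image fun k => g.coeff k), ?_⟩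
      intro Y _ _ _ ev hev hZ
      have hg2 : ∀ g, (g = derivative f ∨ g ∈ F.erase f) → g ∈ F₂ := fun g hg => Finset.mem_insert.2 hg
      have hdeg2 : ∀ g ∈ F₂, g.natDegree ≤ d + 1 := by
        intro g hg
        rcases Finset.mem_insert.1 hg with rfl | hg
        · omega
        · exact hF g (Finset.mem_of_mem_erase hg)
      refine step hev hfd (by omega) (F' := F.erase f) (F₃ := F₃)
        (fun g hg => hF g (Finset.mem_of_mem_erase hg)) ?_ ?_ ?_ ?_ ?_ ?_ ?_ F ?_
      · exact hG Y ev hev fun a ha => hZ a (Finset.mem_insert_of_mem (Finset.mem_union_left _ ha))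
      · intro g hg
        exact Finset.mem_insert_of_mem (Finset.mem_union_left _ (hg2 g (Or.inr hg)))
      · exact Finset.mem_insert_of_mem (Finset.mem_union_left _ (hg2 _ (Or.inl rfl)))
      · exact Finset.mem_insert_self _ _
      · intro g hg k hk
        refine Finset.mem_insert_of_mem (Finset.mem_union_right _ (Finset.mem_biUnion.2
          ⟨g, hg2 g hg, Finset.mem_image.2 ⟨k, Finset.mem_range.2 (by omega), rfl⟩⟩))
      · exact hZ _ (Finset.mem_insert_self _ _)
      · intro g hg k
        by_cases hk : k < d + 2
        · exact hZ _ (Finset.mem_insert_of_mem (Finset.mem_union_right _ (Finset.mem_biUnion.2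
            ⟨g, hg2 g hg, Finset.mem_image.2 ⟨k, Finset.mem_range.2 hk, rfl⟩⟩)))
        · left
          intro y
          have := hdeg2 g (hg2 g hg)
          show ev y (g.coeff k) = 0
          rw [coeff_eq_zero_of_natDegree_lt (by omega), map_zero]
      · intro g hg
        by_cases h : g = f
        · exact Or.inl h
        · exact Or.inr (Finset.mem_erase.2 ⟨h, hg⟩)

lemma Chain.extend {Y : Type*} [TopologicalSpace Y] {Ξ : Set (Y → ℝ)} (hΞ₀ : Chain Ξ) (c : ℝ) :
    ∃ M : Y → ℝ, Chain (insert M (insert (fun y => - M y) Ξ)) ∧ ∀ y, |c| < M y := by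
  let M : Y → ℝ := fun y => |c| + 1 + ∑ ξ ∈ hΞ₀.fin.toFinset, |ξ y|
  have hMc : Continuous M := by
    refine continuous_const.add ?_
    exact continuous_finsetSum _ fun ξ hξ => (hΞ₀.cont ξ (by simpa using hξ)).abs
  have hM2 : ∀ ξ ∈ Ξ, ∀ y, |ξ y| < M y := by
    intro ξ hξ y
    have h1 : |ξ y| ≤ ∑ ξ ∈ hΞ₀.fin.toFinset, |ξ y| :=
      Finset.single_le_sum (f := fun ξ : Y → ℝ => |ξ y|) (fun _ _ => abs_nonneg _) (by simpa using hξ)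
    have h2 := abs_nonneg c
    simp only [M]
    linarith
  have hM3 : ∀ y, |c| < M y := by
    intro y
    have h2 : 0 ≤ ∑ ξ ∈ hΞ₀.fin.toFinset, |ξ y| := Finset.sum_nonneg fun _ _ => abs_nonneg _
    simp only [M]
    linarith
  have hM0 : ∀ y, 0 < M y := fun y => (abs_nonneg c).trans_lt (hM3 y)
  refine ⟨M, ⟨(hΞ₀.fin.insert _).insert _, ?_, ?_⟩, hM3⟩
  · rintro ξ (rfl | rfl | hξ)
    · exact hMc
    · exact hMc.neg
    · exact hΞ₀.cont ξ hξ
  · rintro ξ (rfl | rfl | hξ) η (rfl | rfl | hη)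
    · exact Or.inl rfl
    · exact Or.inr (Or.inr fun y => by linarith [hM0 y])
    · exact Or.inr (Or.inr fun y => (abs_lt.1 (hM2 η hη y)).2)
    · exact Or.inr (Or.inl fun y => by linarith [hM0 y])
    · exact Or.inl rfl
    · exact Or.inr (Or.inl fun y => (abs_lt.1 (hM2 η hη y)).1)
    · exact Or.inr (Or.inl fun y => (abs_lt.1 (hM2 ξ hξ y)).2)
    · exact Or.inr (Or.inr fun y => (abs_lt.1 (hM2 ξ hξ y)).1)
    · exact hΞ₀.cmp ξ hξ η hη

/-- band of a chain over a subset `S` of it -/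
def bandSet {Y : Type*} (Ξ S : Set (Y → ℝ)) : Set (Y × ℝ) :=
  {p | (∀ ξ ∈ S, ξ p.1 < p.2) ∧ ∀ ξ ∈ Ξ, ξ ∉ S → p.2 < ξ p.1}

lemma bandSet_preconnected {Y : Type*} [TopologicalSpace Y] [PreconnectedSpace Y]
    {Ξ S : Set (Y → ℝ)} (h : Chain Ξ) (hS : S ⊆ Ξ) : IsPreconnected (bandSet Ξ S) := by
  rcases (bandSet Ξ S).eq_empty_or_nonempty with h0 | ⟨⟨y₀, t₀⟩, h1, h2⟩
  · rw [h0]; exact isPreconnected_empty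
  simp only at h1 h2
  obtain ⟨M, hM, hMt⟩ := h.extend t₀
  have hsub : Ξ ⊆ insert M (insert (fun y => - M y) Ξ) := fun ξ h => Or.inr (Or.inr h)
  obtain ⟨⟨l, u⟩, hp, hl, hu⟩ := hM.adj (y := y₀) (t := t₀) (a := fun y => - M y) (b := M)
    (Or.inr (Or.inl rfl)) (Or.inl rfl) (abs_lt.1 (hMt y₀)).1 (abs_lt.1 (hMt y₀)).2 (by
      rintro ξ (rfl | rfl | hξ)
      · exact (abs_lt.1 (hMt y₀)).2.ne'
      · exact (abs_lt.1 (hMt y₀)).1.ne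
      · by_cases hξS : ξ ∈ S
        · exact (h1 ξ hξS).ne
        · exact (h2 ξ hξ hξS).ne')
  simp only at hl hu
  have hlc : Continuous l := hM.cont _ hp.1
  have huc : Continuous u := hM.cont _ hp.2.1
  have hlu : ∀ y, l y < u y := hp.2.2.1
  let σ : Y → ℝ := fun y => (l y + u y) / 2
  have hσc : Continuous σ := (hlc.add huc).div_const _
  have hσl : ∀ y, l y < σ y := fun y => by simp only [σ]; linarith [hlu y]
  have hσu : ∀ y, σ y < u y := fun y => by simp only [σ]; linarith [hlu y]
  have hσ : ∀ y, (y, σ y) ∈ bandSet Ξ S := by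
    intro y
    refine ⟨fun ξ hξ => ?_, fun ξ hξ hξS => ?_⟩
    · rcases hp.2.2.2 ξ (hsub (hS hξ)) with h' | h'
      · exact (h' y).trans_lt (hσl y)
      · have a1 := h' y₀
        have a2 := h1 ξ hξ
        simp only at a1
        linarith
    · rcases hp.2.2.2 ξ (hsub hξ) with h' | h'
      · have a1 := h' y₀
        have a2 := h2 ξ hξ hξS
        simp only at a1
        linarith
      · exact (hσu y).trans_le (h' y)
  refine isPreconnected_of_forall (y₀, σ y₀) ?_
  rintro ⟨y, t⟩ hyt
  refine ⟨Set.range (fun y => (y, σ y)) ∪ (fun s => (y, s)) '' Set.uIcc (σ y) t, ?_,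
    Or.inl ⟨y₀, rfl⟩, Or.inr ⟨t, Set.right_mem_uIcc, rfl⟩, ?_⟩
  · rintro _ (⟨z, rfl⟩ | ⟨s, hs, rfl⟩)
    · exact hσ z
    · rw [Set.mem_uIcc] at hs
      refine ⟨fun ξ hξ => ?_, fun ξ hξ hξS => ?_⟩
      · have a1 := hyt.1 ξ hξ
        have a2 := (hσ y).1 ξ hξ
        simp only at a1 a2 ⊢
        rcases hs with hs | hs <;> linarith [hs.1]
      · have a1 := hyt.2 ξ hξ hξS
        have a2 := (hσ y).2 ξ hξ hξS
        simp only at a1 a2 ⊢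
        rcases hs with hs | hs <;> linarith [hs.2]
  · refine IsPreconnected.union (y, σ y) ⟨y, rfl⟩ ⟨σ y, Set.left_mem_uIcc, rfl⟩ ?_ ?_
    · exact isPreconnected_range (continuous_id.prodMk hσc)
    · exact isPreconnected_uIcc.image _ (by fun_prop)

lemma cyl {A : Type*} [CommRing A] {Y : Type*} [TopologicalSpace Y] [PreconnectedSpace Y]
    {ev : Y → A →+* ℝ} {F : Finset A[X]} (hN : Nice ev F) :
    ∃ 𝒟 : Set (Set (Y × ℝ)), 𝒟.Finite ∧ (∀ K ∈ 𝒟, IsPreconnected K) ∧ (∀ p, ∃ K ∈ 𝒟, p ∈ K) ∧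
      ∀ K ∈ 𝒟, ∀ f ∈ F, (∀ p ∈ K, E ev f p.1 p.2 = 0) ∨ (∀ p ∈ K, E ev f p.1 p.2 ≠ 0) := by
  obtain ⟨Ξ, hΞ, hF⟩ := hN
  refine ⟨(fun ξ : Y → ℝ => Set.range fun y => (y, ξ y)) '' Ξ ∪ (bandSet Ξ) '' (𝒫 Ξ),
    (hΞ.fin.image _).union (hΞ.fin.powerset.image _), ?_, ?_, ?_⟩
  · rintro _ (⟨ξ, hξ, rfl⟩ | ⟨S, hS, rfl⟩)
    · exact isPreconnected_range (continuous_id.prodMk (hΞ.cont ξ hξ))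
    · exact bandSet_preconnected hΞ hS
  · rintro ⟨y, t⟩
    by_cases hex : ∃ ξ ∈ Ξ, ξ y = t
    · obtain ⟨ξ, hξ, rfl⟩ := hex
      exact ⟨_, Or.inl ⟨ξ, hξ, rfl⟩, y, rfl⟩
    · push Not at hex
      refine ⟨_, Or.inr ⟨{ξ | ξ ∈ Ξ ∧ ξ y < t}, fun ξ h => h.1, rfl⟩, fun ξ h => h.2, fun ξ hξ h => ?_⟩
      exact lt_of_le_of_ne (not_lt.1 fun h' => h ⟨hξ, h'⟩) (hex ξ hξ).symm
  · rintro _ (⟨ξ, hξ, rfl⟩ | ⟨S, hS, rfl⟩) f hf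
    · rcases (hF f hf).1 ξ hξ with h | h
      · left
        rintro _ ⟨y, rfl⟩
        exact h y
      · right
        rintro _ ⟨y, rfl⟩
        exact h y
    · rcases (hF f hf).2 with h | h
      · exact Or.inl fun p _ => h _ _
      · right
        intro p hp h0
        obtain ⟨ξ, hξ, h1⟩ := h _ _ h0
        by_cases hξS : ξ ∈ S
        · exact (hp.1 ξ hξS).ne h1
        · exact (hp.2 ξ hξ hξS).ne' h1

lemma cells (n : ℕ) : ∀ G : Finset (MvPolynomial (Fin n) ℝ), ∃ 𝒞 : Set (Set (Fin n → ℝ)),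
    𝒞.Finite ∧ (∀ C ∈ 𝒞, IsPreconnected C) ∧ (∀ x, ∃ C ∈ 𝒞, x ∈ C) ∧
    ∀ C ∈ 𝒞, ∀ g ∈ G, (∀ x ∈ C, MvPolynomial.eval x g = 0) ∨ (∀ x ∈ C, MvPolynomial.eval x g ≠ 0) := by
  classical
  induction n with
  | zero =>
    intro G
    refine ⟨{Set.univ}, Set.finite_singleton _, ?_, fun x => ⟨_, rfl, trivial⟩, ?_⟩
    · rintro _ rfl
      exact Set.subsingleton_univ.isPreconnected
    · rintro _ rfl g -
      by_cases h : MvPolynomial.eval (default : Fin 0 → ℝ) g = 0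
      · exact Or.inl fun x _ => by rw [Subsingleton.elim x default]; exact h
      · exact Or.inr fun x _ => by rw [Subsingleton.elim x default]; exact h
  | succ n ih =>
    intro G
    let F := G.image (MvPolynomial.finSuccEquiv ℝ n)
    obtain ⟨G', hG'⟩ := proj (F.sup natDegree) F fun f hf => Finset.le_sup (f := natDegree) hf
    obtain ⟨𝒞, hfin, hpre, hcov, hz⟩ := ih G'
    have key : ∀ C ∈ 𝒞, ∃ 𝒟 : Set (Set (Fin (n + 1) → ℝ)), 𝒟.Finite ∧ (∀ K ∈ 𝒟, IsPreconnected K) ∧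
        (∀ x : Fin n → ℝ, x ∈ C → ∀ t : ℝ, ∃ K ∈ 𝒟, (Fin.cons t x : Fin (n + 1) → ℝ) ∈ K) ∧
        ∀ K ∈ 𝒟, ∀ g ∈ G, (∀ x ∈ K, MvPolynomial.eval x g = 0) ∨
          (∀ x ∈ K, MvPolynomial.eval x g ≠ 0) := by
      intro C hC
      rcases C.eq_empty_or_nonempty with rfl | hne
      · exact ⟨∅, Set.finite_empty, by simp, by simp, by simp⟩
      haveI : PreconnectedSpace C := Subtype.preconnectedSpace (hpre C hC)
      haveI : Nonempty C := hne.to_subtype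
      let ev : C → MvPolynomial (Fin n) ℝ →+* ℝ := fun y => MvPolynomial.eval y.1
      have hN := hG' C ev (fun a => (MvPolynomial.continuous_eval a).comp continuous_subtype_val)
        (fun a ha => (hz C hC a ha).imp (fun h y => h y.1 y.2) (fun h y => h y.1 y.2))
      obtain ⟨𝒟, h1, h2, h3, h4⟩ := cyl hN
      let Φ : C × ℝ → (Fin (n + 1) → ℝ) := fun p => Fin.cons p.2 p.1.1
      have hΦ : Continuous Φ := by
        refine continuous_pi fun i => ?_
        refine Fin.cases ?_ (fun j => ?_) i
        · simpa [Φ] using continuous_snd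
        · simp only [Φ, Fin.cons_succ]
          exact (continuous_apply j).comp (continuous_subtype_val.comp continuous_fst)
      have hE : ∀ g p, MvPolynomial.eval (Φ p) g = E ev (MvPolynomial.finSuccEquiv ℝ n g) p.1 p.2 := by
        intro g p
        rw [MvPolynomial.eval_eq_eval_mv_eval', eval_map]
        rfl
      refine ⟨(fun K => Φ '' K) '' 𝒟, h1.image _, ?_, ?_, ?_⟩
      · rintro _ ⟨K, hK, rfl⟩
        exact (h2 K hK).image _ hΦ.continuousOn
      · intro x hx t
        obtain ⟨K, hK, hp⟩ := h3 (⟨x, hx⟩, t)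
        exact ⟨_, ⟨K, hK, rfl⟩, _, hp, rfl⟩
      · rintro _ ⟨K, hK, rfl⟩ g hg
        refine (h4 K hK _ (Finset.mem_image_of_mem _ hg)).imp ?_ ?_
        · rintro h _ ⟨p, hp, rfl⟩
          rw [hE]; exact h p hp
        · rintro h _ ⟨p, hp, rfl⟩
          rw [hE]; exact h p hp
    choose! 𝒟 k1 k2 k3 k4 using key
    refine ⟨⋃ C ∈ 𝒞, 𝒟 C, hfin.biUnion k1, ?_, ?_, ?_⟩
    · intro K hK
      obtain ⟨C, hC, hK⟩ := Set.mem_iUnion₂.1 hK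
      exact k2 C hC K hK
    · intro x
      obtain ⟨C, hC, hx⟩ := hcov (Fin.tail x)
      obtain ⟨K, hK, h⟩ := k3 C hC _ hx (x 0)
      rw [Fin.cons_self_tail] at h
      exact ⟨K, Set.mem_iUnion₂.2 ⟨C, hC, hK⟩, h⟩
    · intro K hK
      obtain ⟨C, hC, hK⟩ := Set.mem_iUnion₂.1 hK
      exact k4 C hC K hK

lemma finite_components {X : Type*} [TopologicalSpace X] {S : Set X} {𝒞 : Set (Set X)}
    (hfin : 𝒞.Finite) (hpre : ∀ C ∈ 𝒞, IsPreconnected C)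
    (hcov : ∀ x ∈ S, ∃ C ∈ 𝒞, x ∈ C ∧ C ⊆ S) : Finite (ConnectedComponents S) := by
  haveI := hfin.to_subtype
  have H : ∀ c : ConnectedComponents S, ∃ C : 𝒞, ∃ x : S, (x : X) ∈ C.1 ∧ C.1 ⊆ S ∧
      (ConnectedComponents.mk x) = c := by
    intro c
    obtain ⟨x, rfl⟩ := ConnectedComponents.surjective_coe c
    obtain ⟨C, hC, hx, hCS⟩ := hcov x x.2
    exact ⟨⟨C, hC⟩, x, hx, hCS, rfl⟩
  choose φ x h1 h2 h3 using H
  refine Finite.of_injective φ fun c c' hcc => ?_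
  rw [← h3 c, ← h3 c', ConnectedComponents.coe_eq_coe']
  have hp : IsPreconnected ((↑) ⁻¹' (φ c').1 : Set S) := by
    rw [← Topology.IsInducing.subtypeVal.isPreconnected_image, Subtype.image_preimage_coe,
      Set.inter_eq_right.2 (h2 c')]
    exact hpre _ (φ c').2
  exact hp.subset_connectedComponent (h1 c') (by rw [← hcc]; exact h1 c)

end SA

/-- A semi-algebraic set has finitely many connected components. -/
theorem semialgebraic_finite_components {n : ℕ} (S : Set (Fin n → ℝ))
    (h : IsSemialgebraic S) : Finite (ConnectedComponents S) := by
  classical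
  obtain ⟨k, B, hB, rfl⟩ := h
  choose P Q hPQ using hB
  obtain ⟨𝒞, hfin, hpre, hcov, hz⟩ := SA.cells n (Finset.univ.biUnion fun i => P i ∪ Q i)
  refine SA.finite_components hfin hpre fun x hx => ?_
  obtain ⟨C, hC, hxC⟩ := hcov x
  refine ⟨C, hC, hxC, fun z hzC => ?_⟩
  obtain ⟨i, hi⟩ := Set.mem_iUnion.1 hx
  refine Set.mem_iUnion.2 ⟨i, ?_⟩
  rw [hPQ i] at hi ⊢
  refine ⟨fun p hp => ?_, fun q hq => ?_⟩
  · rcases hz C hC p (Finset.mem_biUnion.2 ⟨i, Finset.mem_univ _, Finset.mem_union_left _ hp⟩) with h | h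
    · exact h z hzC
    · exact absurd (hi.1 p hp) (h x hxC)
  · rcases hz C hC q (Finset.mem_biUnion.2 ⟨i, Finset.mem_univ _, Finset.mem_union_right _ hq⟩) with h | h
    · exact (h z hzC).ge
    · haveI : PreconnectedSpace C := Subtype.preconnectedSpace (hpre C hC)
      exact (SA.pos_of_pos (Y := C) (g := fun y => MvPolynomial.eval y.1 q)
        ((MvPolynomial.continuous_eval q).comp continuous_subtype_val) (fun y => h y.1 y.2)
        (a := ⟨x, hxC⟩) (lt_of_le_of_ne (hi.2 q hq) (h x hxC).symm) ⟨z, hzC⟩).le
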